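/- In the McKean–Vlasov setting of Lemma 7.4 — B : [0,T] × ℝ^d × P₁ → ℝ^d continuous in s for fixed (x,ν), satisfying ‖B(s,x,ν) − B(s,x',ν')‖ ≤ L(‖x−x'‖ + ∫‖y−y'‖dπ) for every coupling π of ν and ν', and ‖B(s,x,ν)‖ ≤ L̄(1+‖x‖+‖ν‖₁) — let m, m' ∈ P₁ and let X^{t,m}, X^{t,m'} be the unique jointly continuous linear-growth solutions with initial time t and initial measures m and m' respectively. Then for every coupling π₀ of m' and m, every s ∈ [t,T] and every x ∈ ℝ^d: ‖X^{t,m'}_s(x) − X^{t,m}_s(x)‖ ≤ (∫‖y'−y‖dπ₀(y',y)) · L(s−t) e^{2L(s−t)} (1 + L(s−t) e^{2L(s−t)}), and moreover ∫‖X^{t,m'}_s(y) − X^{t,m}_s(y)‖ dm(y) ≤ (∫‖y'−y‖dπ₀(y',y)) · L(s−t) e^{3L(s−t)}. -/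

import Mathlib

open MeasureTheory Set

/-- Probability measures on `ℝ^d` with finite first moment. -/
def MemP1 {d : ℕ} (μ : Measure (EuclideanSpace ℝ (Fin d))) : Prop :=
  IsProbabilityMeasure μ ∧ Integrable (fun x => ‖x‖) μ

/-- `π` is a coupling of `μ` and `ν`. -/
def IsCoupling {d : ℕ} (π : Measure (EuclideanSpace ℝ (Fin d) × EuclideanSpace ℝ (Fin d)))
    (μ ν : Measure (EuclideanSpace ℝ (Fin d))) : Prop :=
  IsProbabilityMeasure π ∧ π.map Prod.fst = μ ∧ π.map Prod.snd = ν

/-- The first moment `‖ν‖₁ = ∫ ‖y‖ dν(y)`. -/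
noncomputable def mnorm1 {d : ℕ} (ν : Measure (EuclideanSpace ℝ (Fin d))) : ℝ :=
  ∫ y, ‖y‖ ∂ν

/-- Integral form of Grönwall's inequality on a compact interval. -/
theorem le_mul_exp_of_le_add_integral {u : ℝ → ℝ} {a b A K : ℝ} (hK : 0 ≤ K)
    (hu : ContinuousOn u (Icc a b))
    (h : ∀ s ∈ Icc a b, u s ≤ A + K * ∫ τ in a..s, u τ) :
    ∀ s ∈ Icc a b, u s ≤ A * Real.exp (K * (s - a)) := by
  intro s hs
  have hab : a ≤ b := hs.1.trans hs.2
  have hv : Continuous (IccExtend hab ((Icc a b).domRestrict u)) :=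
    (continuousOn_iff_continuous_domRestrict.1 hu).Icc_extend'
  set v := IccExtend hab ((Icc a b).domRestrict u)
  have hvu : ∀ r ∈ Icc a b, v r = u r := fun r hr => by
    simp [v, IccExtend_of_mem hab _ hr, domRestrict]
  have hint : ∀ r ∈ Icc a b, ∫ τ in a..r, u τ = ∫ τ in a..r, v τ := fun r hr => by
    refine intervalIntegral.integral_congr fun τ hτ => ?_
    rw [uIcc_of_le hr.1] at hτ
    exact (hvu τ ⟨hτ.1, hτ.2.trans hr.2⟩).symm
  have hder : ∀ r, HasDerivAt (fun r => A + K * ∫ τ in a..r, v τ) (K * v r) r := fun r =>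
    ((intervalIntegral.integral_hasDerivAt_right (hv.intervalIntegrable _ _)
      (hv.stronglyMeasurableAtFilter _ _) hv.continuousAt).const_mul K).const_add A
  have hG := le_gronwallBound_of_liminf_deriv_right_le (δ := A) (K := K) (ε := 0) (a := a) (b := b)
    (f := fun r => A + K * ∫ τ in a..r, v τ) (f' := fun r => K * v r)
    (fun r _ => (hder r).continuousAt.continuousWithinAt)
    (fun r _ _ hr => (hder r).hasDerivWithinAt.liminf_right_slope_le hr)
    (by simp)
    (fun r hr => by
      have hr' : r ∈ Icc a b := Ico_subset_Icc_self hr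
      have := h r hr'
      rw [hint r hr', ← hvu r hr'] at this
      simpa using mul_le_mul_of_nonneg_left this hK) s hs
  rw [gronwallBound_ε0] at hG
  have := h s hs
  rw [hint s hs] at this
  exact this.trans hG

namespace IsCoupling

variable {d : ℕ} {π : Measure (EuclideanSpace ℝ (Fin d) × EuclideanSpace ℝ (Fin d))}
  {μ ν : Measure (EuclideanSpace ℝ (Fin d))}

theorem diagonal (hμ : IsProbabilityMeasure μ) : IsCoupling (μ.map fun y => (y, y)) μ μ := by
  have hm : Measurable fun y : EuclideanSpace ℝ (Fin d) => (y, y) := by fun_prop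
  refine ⟨Measure.isProbabilityMeasure_map hm.aemeasurable, ?_, ?_⟩
  · rw [Measure.map_map measurable_fst hm]; exact Measure.map_id
  · rw [Measure.map_map measurable_snd hm]; exact Measure.map_id

theorem map (h : IsCoupling π μ ν)
    {Y Z : EuclideanSpace ℝ (Fin d) → EuclideanSpace ℝ (Fin d)}
    (hY : Measurable Y) (hZ : Measurable Z) :
    IsCoupling (π.map (Prod.map Y Z)) (μ.map Y) (ν.map Z) := by
  obtain ⟨h0, h1, h2⟩ := h
  have hm : Measurable (Prod.map Y Z) := hY.prodMap hZ
  refine ⟨Measure.isProbabilityMeasure_map hm.aemeasurable, ?_, ?_⟩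
  · rw [Measure.map_map measurable_fst hm, ← h1, Measure.map_map hY measurable_fst]; rfl
  · rw [Measure.map_map measurable_snd hm, ← h2, Measure.map_map hZ measurable_snd]; rfl

theorem integrable_norm_fst (h : IsCoupling π μ ν) (hμ : MemP1 μ) :
    Integrable (fun q => ‖q.1‖) π := by
  have := hμ.2
  rw [← h.2.1] at this
  exact this.comp_measurable measurable_fst

theorem integrable_norm_snd (h : IsCoupling π μ ν) (hν : MemP1 ν) :
    Integrable (fun q => ‖q.2‖) π := by
  have := hν.2
  rw [← h.2.2] at this
  exact this.comp_measurable measurable_snd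

end IsCoupling

/-- A family of maps `Y s`, `s ∈ [t, T]`, that is jointly continuous and of linear growth in space,
uniformly in time. -/
structure IsLinearGrowthFlow {d : ℕ} (t T : ℝ)
    (Y : ℝ → EuclideanSpace ℝ (Fin d) → EuclideanSpace ℝ (Fin d)) : Prop where
  continuousOn : ContinuousOn (fun q : ℝ × EuclideanSpace ℝ (Fin d) => Y q.1 q.2)
    (Icc t T ×ˢ (univ : Set (EuclideanSpace ℝ (Fin d))))
  growth : ∃ K : ℝ, ∀ s ∈ Icc t T, ∀ x, ‖Y s x‖ ≤ K * (1 + ‖x‖)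

namespace IsLinearGrowthFlow

variable {d : ℕ} {t T : ℝ} {Y Z : ℝ → EuclideanSpace ℝ (Fin d) → EuclideanSpace ℝ (Fin d)}
  {π : Measure (EuclideanSpace ℝ (Fin d) × EuclideanSpace ℝ (Fin d))}
  {μ ν : Measure (EuclideanSpace ℝ (Fin d))}

theorem of_growth_add
    (hc : ContinuousOn (fun q : ℝ × EuclideanSpace ℝ (Fin d) => Y q.1 q.2)
      (Icc t T ×ˢ (univ : Set (EuclideanSpace ℝ (Fin d))))) {c : ℝ} (hc0 : 0 ≤ c)
    (hg : ∃ K : ℝ, ∀ s ∈ Icc t T, ∀ x, ‖Y s x‖ ≤ K * (1 + ‖x‖ + c)) :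
    IsLinearGrowthFlow t T Y := by
  obtain ⟨K, hK⟩ := hg
  refine ⟨hc, |K| * (1 + c), fun s hs x => (hK s hs x).trans ?_⟩
  calc K * (1 + ‖x‖ + c) ≤ |K| * (1 + ‖x‖ + c) := by gcongr; exact le_abs_self K
    _ ≤ |K| * ((1 + c) * (1 + ‖x‖)) := by
      gcongr
      nlinarith [mul_nonneg hc0 (norm_nonneg x)]
    _ = _ := by ring

theorem continuousOn_time (hY : IsLinearGrowthFlow t T Y) (x : EuclideanSpace ℝ (Fin d)) :
    ContinuousOn (fun s => Y s x) (Icc t T) :=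
  hY.continuousOn.comp (f := fun s => (s, x)) (by fun_prop) fun _ hs => ⟨hs, mem_univ _⟩

theorem continuous_space (hY : IsLinearGrowthFlow t T Y) {s : ℝ} (hs : s ∈ Icc t T) :
    Continuous (Y s) := by
  rw [← continuousOn_univ]
  exact hY.continuousOn.comp (f := fun x => (s, x)) (by fun_prop) fun _ hx => ⟨hs, hx⟩

theorem frozen (hY : IsLinearGrowthFlow t T Y) {s₀ : ℝ} (hs₀ : s₀ ∈ Icc t T) :
    IsLinearGrowthFlow t T fun _ => Y s₀ := by
  obtain ⟨K, hK⟩ := hY.growth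
  exact ⟨((hY.continuous_space hs₀).comp continuous_snd).continuousOn,
    K, fun _ _ x => hK s₀ hs₀ x⟩

theorem memP1_map (hY : IsLinearGrowthFlow t T Y) {s : ℝ} (hs : s ∈ Icc t T) (hμ : MemP1 μ) :
    MemP1 (μ.map (Y s)) := by
  obtain ⟨K, hK⟩ := hY.growth
  have := hμ.1
  have hm := (hY.continuous_space hs).measurable
  refine ⟨Measure.isProbabilityMeasure_map hm.aemeasurable, ?_⟩
  rw [integrable_map_measure (by fun_prop) hm.aemeasurable]
  refine Integrable.mono' (((integrable_const 1).add hμ.2).const_mul K)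
    (by fun_prop) (Filter.Eventually.of_forall fun x => ?_)
  simpa using hK s hs x

/-- The distance between two flows is dominated by a function integrable for every coupling of
measures with finite first moment. -/
theorem exists_integrable_bound (hY : IsLinearGrowthFlow t T Y) (hZ : IsLinearGrowthFlow t T Z)
    (hμ : MemP1 μ) (hν : MemP1 ν) (hπ : IsCoupling π μ ν) :
    ∃ g : EuclideanSpace ℝ (Fin d) × EuclideanSpace ℝ (Fin d) → ℝ, Integrable g π ∧
      ∀ s ∈ Icc t T, ∀ q, ‖Y s q.1 - Z s q.2‖ ≤ g q := by
  obtain ⟨K, hK⟩ := hY.growth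
  obtain ⟨K', hK'⟩ := hZ.growth
  have := hπ.1
  exact ⟨fun q => K * (1 + ‖q.1‖) + K' * (1 + ‖q.2‖),
    (((integrable_const 1).add (hπ.integrable_norm_fst hμ)).const_mul K).add
      (((integrable_const 1).add (hπ.integrable_norm_snd hν)).const_mul K'),
    fun s hs q => (norm_sub_le _ _).trans (add_le_add (hK s hs _) (hK' s hs _))⟩

theorem aestronglyMeasurable_norm_sub (hY : IsLinearGrowthFlow t T Y)
    (hZ : IsLinearGrowthFlow t T Z) {s : ℝ} (hs : s ∈ Icc t T) :
    AEStronglyMeasurable (fun q => ‖Y s q.1 - Z s q.2‖) π :=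
  (((hY.continuous_space hs).comp continuous_fst).sub
    ((hZ.continuous_space hs).comp continuous_snd)).norm.aestronglyMeasurable

theorem integrable_norm_sub (hY : IsLinearGrowthFlow t T Y) (hZ : IsLinearGrowthFlow t T Z)
    (hμ : MemP1 μ) (hν : MemP1 ν) (hπ : IsCoupling π μ ν) {s : ℝ} (hs : s ∈ Icc t T) :
    Integrable (fun q => ‖Y s q.1 - Z s q.2‖) π := by
  obtain ⟨g, hg, hb⟩ := hY.exists_integrable_bound hZ hμ hν hπ
  exact hg.mono' (hY.aestronglyMeasurable_norm_sub hZ hs)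
    (Filter.Eventually.of_forall fun q => by simpa using hb s hs q)

theorem continuousOn_integral_norm_sub (hY : IsLinearGrowthFlow t T Y)
    (hZ : IsLinearGrowthFlow t T Z) (hμ : MemP1 μ) (hν : MemP1 ν) (hπ : IsCoupling π μ ν) :
    ContinuousOn (fun s => ∫ q, ‖Y s q.1 - Z s q.2‖ ∂π) (Icc t T) := by
  obtain ⟨g, hg, hb⟩ := hY.exists_integrable_bound hZ hμ hν hπ
  exact continuousOn_of_dominated (fun s hs => hY.aestronglyMeasurable_norm_sub hZ hs)
    (fun s hs => Filter.Eventually.of_forall fun q => by simpa using hb s hs q) hg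
    (Filter.Eventually.of_forall fun q =>
      ((hY.continuousOn_time q.1).sub (hZ.continuousOn_time q.2)).norm)

theorem integrable_prod_norm_sub (hY : IsLinearGrowthFlow t T Y)
    (hZ : IsLinearGrowthFlow t T Z) (hμ : MemP1 μ) (hν : MemP1 ν) (hπ : IsCoupling π μ ν)
    {s : ℝ} (hs : s ∈ Icc t T) :
    Integrable (Function.uncurry fun τ q => ‖Y τ q.1 - Z τ q.2‖)
      ((volume.restrict (uIoc t s)).prod π) := by
  obtain ⟨g, hg, hb⟩ := hY.exists_integrable_bound hZ hμ hν hπ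
  have := hπ.1
  have hsub : uIoc t s ⊆ Icc t T := by
    rw [uIoc_of_le hs.1]
    exact fun τ hτ => ⟨hτ.1.le, hτ.2.trans hs.2⟩
  have hmeas : MeasurableSet (uIoc t s ×ˢ
      (univ : Set (EuclideanSpace ℝ (Fin d) × EuclideanSpace ℝ (Fin d)))) :=
    measurableSet_uIoc.prod MeasurableSet.univ
  have hprod : (volume.restrict (uIoc t s)).prod π
      = (volume.prod π).restrict (uIoc t s ×ˢ univ) := by
    rw [← Measure.prod_restrict, Measure.restrict_univ]
  have hfin : IsFiniteMeasure (volume.restrict (uIoc t s)) :=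
    ⟨by simp [uIoc_of_le hs.1]⟩
  refine (hg.comp_snd (volume.restrict (uIoc t s))).mono' ?_ ?_
  · rw [hprod]
    refine ContinuousOn.aestronglyMeasurable ?_ hmeas
    exact ((hY.continuousOn.comp (f := fun p : ℝ × EuclideanSpace ℝ (Fin d) ×
        EuclideanSpace ℝ (Fin d) => (p.1, p.2.1)) (by fun_prop)
        fun p hp => ⟨hsub hp.1, mem_univ _⟩).sub
      (hZ.continuousOn.comp (f := fun p : ℝ × EuclideanSpace ℝ (Fin d) ×
        EuclideanSpace ℝ (Fin d) => (p.1, p.2.2)) (by fun_prop)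
        fun p hp => ⟨hsub hp.1, mem_univ _⟩)).norm
  · rw [hprod]
    refine (ae_restrict_mem hmeas).mono fun p hp => ?_
    simpa [Function.uncurry] using hb p.1 (hsub hp.1) p.2

variable {L : ℝ} {B : ℝ → EuclideanSpace ℝ (Fin d) → Measure (EuclideanSpace ℝ (Fin d)) →
  EuclideanSpace ℝ (Fin d)}

theorem norm_velocity_sub_le
    (hBlip : ∀ s x x' ν ν' π, MemP1 ν → MemP1 ν' → IsCoupling π ν ν' →
      ‖B s x ν - B s x' ν'‖ ≤ L * (‖x - x'‖ + ∫ q, ‖q.1 - q.2‖ ∂π))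
    (hY : IsLinearGrowthFlow t T Y) (hZ : IsLinearGrowthFlow t T Z)
    (hμ : MemP1 μ) (hν : MemP1 ν) (hπ : IsCoupling π μ ν) {s : ℝ} (hs : s ∈ Icc t T)
    (r : ℝ) (x x' : EuclideanSpace ℝ (Fin d)) :
    ‖B r x (μ.map (Y s)) - B r x' (ν.map (Z s))‖ ≤
      L * (‖x - x'‖ + ∫ q, ‖Y s q.1 - Z s q.2‖ ∂π) := by
  have hYm := (hY.continuous_space hs).measurable
  have hZm := (hZ.continuous_space hs).measurable
  refine (hBlip r x x' _ _ _ (hY.memP1_map hs hμ) (hZ.memP1_map hs hν)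
    (hπ.map hYm hZm)).trans_eq ?_
  rw [integral_map (hYm.prodMap hZm).aemeasurable (by fun_prop)]
  rfl

theorem continuousOn_velocity
    (hBcont : ∀ x ν, MemP1 ν → ContinuousOn (fun s => B s x ν) (Icc 0 T))
    (hBlip : ∀ s x x' ν ν' π, MemP1 ν → MemP1 ν' → IsCoupling π ν ν' →
      ‖B s x ν - B s x' ν'‖ ≤ L * (‖x - x'‖ + ∫ q, ‖q.1 - q.2‖ ∂π))
    (ht : 0 ≤ t) (hY : IsLinearGrowthFlow t T Y) (hμ : MemP1 μ)
    (x : EuclideanSpace ℝ (Fin d)) :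
    ContinuousOn (fun s => B s (Y s x) (μ.map (Y s))) (Icc t T) := by
  intro s₀ hs₀
  have hdiag := IsCoupling.diagonal hμ.1
  have hF := hY.frozen hs₀
  have h1 : ContinuousWithinAt (fun s => B s (Y s₀ x) (μ.map (Y s₀))) (Icc t T) s₀ :=
    ((hBcont (Y s₀ x) _ (hY.memP1_map hs₀ hμ)).mono (Icc_subset_Icc_left ht)) s₀ hs₀
  have h2 : ContinuousWithinAt (fun s => L * (‖Y s x - Y s₀ x‖ +
      ∫ q, ‖Y s q.1 - Y s₀ q.2‖ ∂(μ.map fun y => (y, y)))) (Icc t T) s₀ :=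
    (((hY.continuousOn_time x).sub continuousOn_const).norm.add
      (hY.continuousOn_integral_norm_sub hF hμ hμ hdiag)).const_smul L s₀ hs₀
  have h20 : L * (‖Y s₀ x - Y s₀ x‖ +
      ∫ q, ‖Y s₀ q.1 - Y s₀ q.2‖ ∂(μ.map fun y => (y, y))) = 0 := by
    have hYc := hY.continuous_space hs₀
    rw [integral_map (by fun_prop) (by fun_prop)]
    simp
  have h3 : Filter.Tendsto (fun s => B s (Y s x) (μ.map (Y s)) - B s (Y s₀ x) (μ.map (Y s₀)))
      (nhdsWithin s₀ (Icc t T)) (nhds 0) := by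
    refine squeeze_zero_norm' ?_ (h20 ▸ h2.tendsto)
    filter_upwards [self_mem_nhdsWithin] with s hs
    exact hY.norm_velocity_sub_le hBlip hF hμ hμ hdiag hs s _ _
  have h4 := h3.add h1.tendsto
  simpa [ContinuousWithinAt] using h4

/-- Two solutions with different initial points and measures stay close, up to the time integral of
their distance and of the transport cost of their laws. -/
theorem norm_sub_le_add_integral
    (hBcont : ∀ x ν, MemP1 ν → ContinuousOn (fun s => B s x ν) (Icc 0 T))
    (hBlip : ∀ s x x' ν ν' π, MemP1 ν → MemP1 ν' → IsCoupling π ν ν' →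
      ‖B s x ν - B s x' ν'‖ ≤ L * (‖x - x'‖ + ∫ q, ‖q.1 - q.2‖ ∂π))
    (ht : 0 ≤ t) (hY : IsLinearGrowthFlow t T Y) (hZ : IsLinearGrowthFlow t T Z)
    (hμ : MemP1 μ) (hν : MemP1 ν) (hπ : IsCoupling π μ ν)
    (hYeq : ∀ s ∈ Icc t T, ∀ x, Y s x = x + ∫ τ in t..s, B τ (Y τ x) (μ.map (Y τ)))
    (hZeq : ∀ s ∈ Icc t T, ∀ x, Z s x = x + ∫ τ in t..s, B τ (Z τ x) (ν.map (Z τ)))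
    {s : ℝ} (hs : s ∈ Icc t T) (x y : EuclideanSpace ℝ (Fin d)) :
    ‖Y s x - Z s y‖ ≤ ‖x - y‖ + L * ((∫ τ in t..s, ‖Y τ x - Z τ y‖) +
      ∫ τ in t..s, ∫ q, ‖Y τ q.1 - Z τ q.2‖ ∂π) := by
  have hsub : uIcc t s ⊆ Icc t T := by
    rw [uIcc_of_le hs.1]
    exact Icc_subset_Icc_right hs.2
  have i1 := ((hY.continuousOn_velocity hBcont hBlip ht hμ x).mono
    hsub).intervalIntegrable (μ := volume)
  have i2 := ((hZ.continuousOn_velocity hBcont hBlip ht hν y).mono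
    hsub).intervalIntegrable (μ := volume)
  have i3 : IntervalIntegrable (fun τ => ‖Y τ x - Z τ y‖) volume t s :=
    (((hY.continuousOn_time x).sub (hZ.continuousOn_time y)).norm.mono hsub).intervalIntegrable
  have i4 := ((hY.continuousOn_integral_norm_sub hZ hμ hν hπ).mono
    hsub).intervalIntegrable (μ := volume)
  have hsplit : Y s x - Z s y = (x - y) + ∫ τ in t..s,
      (B τ (Y τ x) (μ.map (Y τ)) - B τ (Z τ y) (ν.map (Z τ))) := by
    rw [intervalIntegral.integral_sub i1 i2, hYeq s hs x, hZeq s hs y]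
    abel
  rw [hsplit, ← intervalIntegral.integral_add i3 i4, ← intervalIntegral.integral_const_mul]
  refine (norm_add_le _ _).trans (add_le_add le_rfl ?_)
  refine intervalIntegral.norm_integral_le_of_norm_le hs.1
    (Filter.Eventually.of_forall fun τ hτ => ?_) ((i3.add i4).const_mul L)
  exact hY.norm_velocity_sub_le hBlip hZ hμ hν hπ ⟨hτ.1.le, hτ.2.trans hs.2⟩ τ _ _

/-- Grönwall estimate for the transport cost along two solutions. -/
theorem integral_norm_sub_le
    (hL : 0 ≤ L)
    (hBcont : ∀ x ν, MemP1 ν → ContinuousOn (fun s => B s x ν) (Icc 0 T))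
    (hBlip : ∀ s x x' ν ν' π, MemP1 ν → MemP1 ν' → IsCoupling π ν ν' →
      ‖B s x ν - B s x' ν'‖ ≤ L * (‖x - x'‖ + ∫ q, ‖q.1 - q.2‖ ∂π))
    (ht : 0 ≤ t) (hY : IsLinearGrowthFlow t T Y) (hZ : IsLinearGrowthFlow t T Z)
    (hμ : MemP1 μ) (hν : MemP1 ν) (hπ : IsCoupling π μ ν)
    (hYeq : ∀ s ∈ Icc t T, ∀ x, Y s x = x + ∫ τ in t..s, B τ (Y τ x) (μ.map (Y τ)))
    (hZeq : ∀ s ∈ Icc t T, ∀ x, Z s x = x + ∫ τ in t..s, B τ (Z τ x) (ν.map (Z τ))) :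
    ∀ s ∈ Icc t T, (∫ q, ‖Y s q.1 - Z s q.2‖ ∂π) ≤
      (∫ q, ‖q.1 - q.2‖ ∂π) * Real.exp (2 * L * (s - t)) := by
  have := hπ.1
  refine le_mul_exp_of_le_add_integral (by positivity)
    (hY.continuousOn_integral_norm_sub hZ hμ hν hπ) fun s hs => ?_
  have hprod := hY.integrable_prod_norm_sub hZ hμ hν hπ hs
  have hswap := intervalIntegral_integral_swap hprod
  have j1 : Integrable (fun q : EuclideanSpace ℝ (Fin d) × EuclideanSpace ℝ (Fin d) =>
      ‖q.1 - q.2‖) π :=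
    ((hπ.integrable_norm_fst hμ).add (hπ.integrable_norm_snd hν)).mono'
      (by fun_prop) (Filter.Eventually.of_forall fun q => by simpa using norm_sub_le q.1 q.2)
  have j2 : Integrable (fun q => ∫ τ in t..s, ‖Y τ q.1 - Z τ q.2‖) π := by
    simpa [intervalIntegral.integral_of_le hs.1, uIoc_of_le hs.1, Function.uncurry]
      using hprod.integral_prod_right
  have j3 : Integrable (fun _ : EuclideanSpace ℝ (Fin d) × EuclideanSpace ℝ (Fin d) =>
      ∫ τ in t..s, ∫ q, ‖Y τ q.1 - Z τ q.2‖ ∂π) π := integrable_const _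
  have hle := integral_mono (hY.integrable_norm_sub hZ hμ hν hπ hs)
    (j1.add ((j2.add j3).const_mul L)) fun q =>
      hY.norm_sub_le_add_integral hBcont hBlip ht hZ hμ hν hπ hYeq hZeq hs q.1 q.2
  refine hle.trans_eq ?_
  rw [integral_add' j1 ((j2.add j3).const_mul L), integral_const_mul, integral_add' j2 j3, ← hswap,
    integral_const, probReal_univ, one_smul]
  ring

/-- Pointwise stability of solutions with respect to the initial measure. -/
theorem norm_sub_le_mul_exp
    (hL : 0 ≤ L)
    (hBcont : ∀ x ν, MemP1 ν → ContinuousOn (fun s => B s x ν) (Icc 0 T))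
    (hBlip : ∀ s x x' ν ν' π, MemP1 ν → MemP1 ν' → IsCoupling π ν ν' →
      ‖B s x ν - B s x' ν'‖ ≤ L * (‖x - x'‖ + ∫ q, ‖q.1 - q.2‖ ∂π))
    (ht : 0 ≤ t) (hY : IsLinearGrowthFlow t T Y) (hZ : IsLinearGrowthFlow t T Z)
    (hμ : MemP1 μ) (hν : MemP1 ν) (hπ : IsCoupling π μ ν)
    (hYeq : ∀ s ∈ Icc t T, ∀ x, Y s x = x + ∫ τ in t..s, B τ (Y τ x) (μ.map (Y τ)))
    (hZeq : ∀ s ∈ Icc t T, ∀ x, Z s x = x + ∫ τ in t..s, B τ (Z τ x) (ν.map (Z τ)))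
    {s : ℝ} (hs : s ∈ Icc t T) (x : EuclideanSpace ℝ (Fin d)) :
    ‖Y s x - Z s x‖ ≤ (∫ q, ‖q.1 - q.2‖ ∂π) * (L * (s - t)) * Real.exp (2 * L * (s - t)) *
      Real.exp (L * (s - t)) := by
  have hW : 0 ≤ ∫ q, ‖q.1 - q.2‖ ∂π := integral_nonneg fun _ => norm_nonneg _
  have hsub : Icc t s ⊆ Icc t T := Icc_subset_Icc_right hs.2
  refine le_mul_exp_of_le_add_integral (u := fun r => ‖Y r x - Z r x‖) (b := s) hL
    (((hY.continuousOn_time x).sub (hZ.continuousOn_time x)).norm.mono hsub)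
    (fun r hr => ?_) s ⟨hs.1, le_rfl⟩
  have h1 := hY.norm_sub_le_add_integral hBcont hBlip ht hZ hμ hν hπ hYeq hZeq (hsub hr) x x
  have h2 : (∫ τ in t..r, ∫ q, ‖Y τ q.1 - Z τ q.2‖ ∂π) ≤
      ∫ _ in t..r, (∫ q, ‖q.1 - q.2‖ ∂π) * Real.exp (2 * L * (s - t)) := by
    refine intervalIntegral.integral_mono_on hr.1 ?_ (by simp) fun τ hτ => ?_
    · refine ((hY.continuousOn_integral_norm_sub hZ hμ hν hπ).mono
        ?_).intervalIntegrable (μ := volume)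
      rw [uIcc_of_le hr.1]
      exact Icc_subset_Icc_right (hsub hr).2
    · refine (hY.integral_norm_sub_le hL hBcont hBlip ht hZ hμ hν hπ hYeq hZeq τ
        (hsub ⟨hτ.1, hτ.2.trans hr.2⟩)).trans ?_
      have := hτ.2.trans hr.2
      gcongr
  have h3 : (∫ τ in t..r, ∫ q, ‖Y τ q.1 - Z τ q.2‖ ∂π) ≤
      (s - t) * ((∫ q, ‖q.1 - q.2‖ ∂π) * Real.exp (2 * L * (s - t))) := by
    refine h2.trans ?_
    rw [intervalIntegral.integral_const, smul_eq_mul]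
    have := hr.2
    gcongr
  rw [sub_self, norm_zero, zero_add, mul_add] at h1
  have h4 := mul_le_mul_of_nonneg_left h3 hL
  linarith

end IsLinearGrowthFlow

theorem Real.exp_le_one_add_mul_exp (a : ℝ) : Real.exp a ≤ 1 + a * Real.exp a := by
  have h := mul_le_mul_of_nonneg_right (Real.add_one_le_exp (-a)) (Real.exp_pos a).le
  rw [← Real.exp_add, neg_add_cancel, Real.exp_zero] at h
  linarith

/-- estimates (7.10) and (7.26) of Lemma 7.4: Lipschitz continuity of the
McKean–Vlasov flow in the initial measure, with the `W₁` distance expressed via couplings. -/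
theorem stmt_12 (d : ℕ) (hd : 1 ≤ d) (T L Lb : ℝ) (hT : 0 < T) (hL : 0 < L) (hLb : 0 < Lb)
    (B : ℝ → EuclideanSpace ℝ (Fin d) → Measure (EuclideanSpace ℝ (Fin d)) →
      EuclideanSpace ℝ (Fin d))
    (hBcont : ∀ x ν, MemP1 ν → ContinuousOn (fun s => B s x ν) (Icc 0 T))
    (hBlip : ∀ s x x' ν ν' π, MemP1 ν → MemP1 ν' → IsCoupling π ν ν' →
      ‖B s x ν - B s x' ν'‖ ≤ L * (‖x - x'‖ + ∫ q, ‖q.1 - q.2‖ ∂π))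
    (hBgrow : ∀ s x ν, MemP1 ν → ‖B s x ν‖ ≤ Lb * (1 + ‖x‖ + mnorm1 ν))
    (t : ℝ) (ht : t ∈ Icc 0 T)
    (m m' : Measure (EuclideanSpace ℝ (Fin d))) (hm : MemP1 m) (hm' : MemP1 m')
    -- `X` is the unique jointly continuous linear-growth solution with data `(t, m)`
    (X : ℝ → EuclideanSpace ℝ (Fin d) → EuclideanSpace ℝ (Fin d))
    (hXcont : ContinuousOn (fun q : ℝ × EuclideanSpace ℝ (Fin d) => X q.1 q.2)
      (Icc t T ×ˢ (univ : Set (EuclideanSpace ℝ (Fin d)))))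
    (hXgrow : ∃ K : ℝ, ∀ s ∈ Icc t T, ∀ x, ‖X s x‖ ≤ K * (1 + ‖x‖ + mnorm1 m))
    (hXeq : ∀ s ∈ Icc t T, ∀ x,
      X s x = x + ∫ τ in t..s, B τ (X τ x) (Measure.map (X τ) m))
    -- `X'` is the unique jointly continuous linear-growth solution with data `(t, m')`
    (X' : ℝ → EuclideanSpace ℝ (Fin d) → EuclideanSpace ℝ (Fin d))
    (hX'cont : ContinuousOn (fun q : ℝ × EuclideanSpace ℝ (Fin d) => X' q.1 q.2)
      (Icc t T ×ˢ (univ : Set (EuclideanSpace ℝ (Fin d)))))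
    (hX'grow : ∃ K : ℝ, ∀ s ∈ Icc t T, ∀ x, ‖X' s x‖ ≤ K * (1 + ‖x‖ + mnorm1 m'))
    (hX'eq : ∀ s ∈ Icc t T, ∀ x,
      X' s x = x + ∫ τ in t..s, B τ (X' τ x) (Measure.map (X' τ) m')) :
    ∀ π₀, IsCoupling π₀ m' m →
      (∀ s ∈ Icc t T, ∀ x : EuclideanSpace ℝ (Fin d),
        ‖X' s x - X s x‖ ≤
          (∫ q, ‖q.1 - q.2‖ ∂π₀) * (L * (s - t)) * Real.exp (2 * L * (s - t)) *
            (1 + L * (s - t) * Real.exp (2 * L * (s - t)))) ∧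
      (∀ s ∈ Icc t T,
        (∫ y, ‖X' s y - X s y‖ ∂m) ≤
          (∫ q, ‖q.1 - q.2‖ ∂π₀) * (L * (s - t)) * Real.exp (3 * L * (s - t))) := by
  intro π₀ hπ
  have hXf := IsLinearGrowthFlow.of_growth_add hXcont
    (integral_nonneg fun _ => norm_nonneg _) hXgrow
  have hX'f := IsLinearGrowthFlow.of_growth_add hX'cont
    (integral_nonneg fun _ => norm_nonneg _) hX'grow
  have hW : 0 ≤ ∫ q, ‖q.1 - q.2‖ ∂π₀ := integral_nonneg fun _ => norm_nonneg _
  have key := fun s (hs : s ∈ Icc t T) => hX'f.norm_sub_le_mul_exp hL.le hBcont hBlip ht.1 hXf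
    hm' hm hπ hX'eq hXeq hs
  refine ⟨fun s hs x => (key s hs x).trans ?_, fun s hs => ?_⟩
  · have hst : 0 ≤ s - t := sub_nonneg.2 hs.1
    refine mul_le_mul_of_nonneg_left ?_ (by positivity)
    refine (Real.exp_le_one_add_mul_exp _).trans ?_
    gcongr
    linarith
  · have := hm.1
    have hle := integral_mono_of_nonneg (μ := m) (Filter.Eventually.of_forall fun y =>
      norm_nonneg (X' s y - X s y)) (integrable_const _) (Filter.Eventually.of_forall (key s hs))
    refine hle.trans_eq ?_
    simp only [integral_const, probReal_univ, one_smul]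
    rw [mul_assoc _ (Real.exp _), ← Real.exp_add]
    ring_nf
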